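/- Let α̂ be the 'one-hot evidence' Dirichlet target with α̂_{c*} = 2 and α̂_i = 1 for all i ≠ c*. Then the uncertainty cross-entropy loss L^{UCE} = ψ(α_0) - ψ(α_{c*}) satisfies L^{UCE} = KL(Dir(α) || Dir(α̂)) + H(Dir(α)) - log B(α̂). -/

import Mathlib

open MeasureTheory Real BigOperators

/-- The digamma function `ψ = (log ∘ Γ)'`. -/
noncomputable def digamma (x : ℝ) : ℝ := deriv (fun y => Real.log (Real.Gamma y)) x

/-- The trigamma function `ψ₁ = ψ'`. -/
noncomputable def trigamma (x : ℝ) : ℝ := deriv digamma x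

/-- The multivariate Beta function `B(α) = (∏ᵢ Γ(αᵢ)) / Γ(∑ᵢ αᵢ)`. -/
noncomputable def mvBeta {C : ℕ} (α : Fin C → ℝ) : ℝ :=
  (∏ i, Real.Gamma (α i)) / Real.Gamma (∑ i, α i)

/-- The Dirichlet density `D(p | α) = (1 / B(α)) ∏ᵢ pᵢ^(αᵢ - 1)`. -/
noncomputable def dirichletDensity {C : ℕ} (α p : Fin C → ℝ) : ℝ :=
  (∏ i, p i ^ (α i - 1)) / mvBeta α

/-- Expectation `E_{p ~ Dir(α)}[g p]` for a Dirichlet distribution with `C + 1` categories,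
written as an integral over the first `C` coordinates (the last coordinate being
`1 - ∑` of the others), against the Dirichlet density on the simplex. -/
noncomputable def dirichletExp {C : ℕ} (α : Fin (C + 1) → ℝ) (g : (Fin (C + 1) → ℝ) → ℝ) : ℝ :=
  ∫ x : Fin C → ℝ,
    Set.indicator {x : Fin C → ℝ | (∀ i, 0 ≤ x i) ∧ ∑ i, x i ≤ 1}
      (fun x =>
        dirichletDensity α (Fin.snoc x (1 - ∑ i, x i)) *
          g (Fin.snoc x (1 - ∑ i, x i))) x

/-- Kullback–Leibler divergence `KL(Dir(α) ‖ Dir(α̂)) = E_{p ~ Dir(α)}[log (D(p|α)/D(p|α̂))]`. -/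
noncomputable def dirichletKL {C : ℕ} (α αhat : Fin (C + 1) → ℝ) : ℝ :=
  dirichletExp α (fun p => Real.log (dirichletDensity α p / dirichletDensity αhat p))

/-- Differential entropy `H(Dir(α)) = E_{p ~ Dir(α)}[- log D(p|α)]`. -/
noncomputable def dirichletEntropy {C : ℕ} (α : Fin (C + 1) → ℝ) : ℝ :=
  dirichletExp α (fun p => - Real.log (dirichletDensity α p))

open ProbabilityTheory
open scoped ENNReal

/-- The function `y ↦ y ^ (a - 1)` on the positive half line, extended by zero. -/
noncomputable def posRpow (a y : ℝ) : ℝ≥0∞ := if 0 < y then ENNReal.ofReal (y ^ (a - 1)) else 0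

@[fun_prop]
lemma measurable_posRpow (a : ℝ) : Measurable (posRpow a) :=
  Measurable.ite measurableSet_Ioi (by fun_prop) measurable_const

lemma posRpow_of_pos {a y : ℝ} (hy : 0 < y) : posRpow a y = ENNReal.ofReal (y ^ (a - 1)) :=
  if_pos hy

lemma posRpow_of_nonpos {a y : ℝ} (hy : y ≤ 0) : posRpow a y = 0 := if_neg hy.not_gt

lemma posRpow_eq_zero_iff {a y : ℝ} : posRpow a y = 0 ↔ y ≤ 0 := by
  refine ⟨fun h => ?_, posRpow_of_nonpos⟩
  by_contra! hy
  rw [posRpow_of_pos hy, ENNReal.ofReal_eq_zero] at h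
  exact h.not_gt (Real.rpow_pos_of_pos hy _)

lemma posRpow_mul_exp_log (a s y : ℝ) :
    posRpow a y * ENNReal.ofReal (Real.exp (s * Real.log y)) = posRpow (a + s) y := by
  rcases lt_or_ge 0 y with hy | hy
  · rw [posRpow_of_pos hy, posRpow_of_pos hy, ← ENNReal.ofReal_mul (by positivity), mul_comm s,
      ← Real.rpow_def_of_pos hy, ← Real.rpow_add hy]
    ring_nf
  · simp [posRpow_of_nonpos hy]

/-- Euler's Beta integral as a convolution of powers. -/
lemma lintegral_posRpow_mul_posRpow {a b : ℝ} (ha : 0 < a) (hb : 0 < b) (t : ℝ) :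
    ∫⁻ y, posRpow a y * posRpow b (t - y) = ENNReal.ofReal (beta a b) * posRpow (a + b) t := by
  rcases lt_or_ge 0 t with ht | ht
  · have hB := beta_pos ha hb
    have key (u : ℝ) : posRpow a (t * u) * posRpow b (t - t * u) =
        ENNReal.ofReal (t ^ (a + b - 2) * beta a b) * betaPDF a b u := by
      rcases le_or_gt u 0 with hu | hu
      · rw [posRpow_of_nonpos (mul_nonpos_of_nonneg_of_nonpos ht.le hu),
          betaPDF_eq_zero_of_nonpos hu, zero_mul, mul_zero]
      rcases le_or_gt 1 u with hu' | hu'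
      · rw [posRpow_of_nonpos (y := t - t * u) (by nlinarith),
          betaPDF_eq_zero_of_one_le hu', mul_zero, mul_zero]
      have h1 : 0 < 1 - u := by linarith
      rw [betaPDF_of_pos_lt_one hu hu', show t - t * u = t * (1 - u) by ring,
        posRpow_of_pos (by positivity), posRpow_of_pos (by positivity),
        ← ENNReal.ofReal_mul (by positivity), ← ENNReal.ofReal_mul (by positivity),
        Real.mul_rpow ht.le hu.le, Real.mul_rpow ht.le h1.le,
        show a + b - 2 = (a - 1) + (b - 1) by ring, Real.rpow_add ht]
      congr 1
      field_simp
    rw [← Real.smul_map_volume_mul_left ht.ne', lintegral_smul_measure,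
      lintegral_map (by fun_prop) (by fun_prop)]
    simp_rw [key]
    have hm : Measurable (betaPDF a b) := by unfold betaPDF; fun_prop
    rw [lintegral_const_mul _ hm, lintegral_betaPDF_eq_one ha hb,
      mul_one, posRpow_of_pos ht, smul_eq_mul, abs_of_pos ht, ← ENNReal.ofReal_mul ht.le,
      ← ENNReal.ofReal_mul hB.le]
    congr 1
    rw [show a + b - 1 = 1 + (a + b - 2) by ring, Real.rpow_add ht, Real.rpow_one]
    ring
  · rw [posRpow_of_nonpos ht, mul_zero, ← lintegral_zero (α := ℝ)]
    refine lintegral_congr fun y => ?_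
    rcases lt_or_ge 0 y with hy | hy
    · rw [posRpow_of_nonpos (y := t - y) (by linarith), mul_zero]
    · rw [posRpow_of_nonpos hy, zero_mul]

/-- The point with first coordinates `x` whose coordinates sum to `t`. -/
noncomputable def simplexPoint {C : ℕ} (t : ℝ) (x : Fin C → ℝ) : Fin (C + 1) → ℝ :=
  Fin.snoc x (t - ∑ i, x i)

@[fun_prop]
lemma measurable_simplexPoint {C : ℕ} (t : ℝ) :
    Measurable (simplexPoint t : (Fin C → ℝ) → Fin (C + 1) → ℝ) := by
  refine measurable_pi_lambda _ fun i => ?_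
  unfold simplexPoint
  refine Fin.lastCases ?_ (fun j => ?_) i
  · simp only [Fin.snoc_last]
    fun_prop
  · simp only [Fin.snoc_castSucc]
    fun_prop

lemma simplexPoint_cons {C : ℕ} (t y : ℝ) (x : Fin C → ℝ) :
    simplexPoint t (Fin.cons y x : Fin (C + 1) → ℝ) = Fin.cons y (simplexPoint (t - y) x) := by
  simp only [simplexPoint]
  rw [Fin.cons_snoc_eq_snoc_cons, Fin.sum_cons, sub_sub]

/-- The unnormalised Dirichlet density on the open simplex of size `t`. -/
noncomputable def dirichletWeight {C : ℕ} (α : Fin (C + 1) → ℝ) (t : ℝ) (x : Fin C → ℝ) : ℝ≥0∞ :=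
  ∏ i, posRpow (α i) (simplexPoint t x i)

@[fun_prop]
lemma measurable_dirichletWeight {C : ℕ} (α : Fin (C + 1) → ℝ) (t : ℝ) :
    Measurable (dirichletWeight α t) := by
  unfold dirichletWeight
  fun_prop

lemma mvBeta_pos {C : ℕ} {α : Fin (C + 1) → ℝ} (hα : ∀ i, 0 < α i) : 0 < mvBeta α :=
  div_pos (Finset.prod_pos fun i _ => Real.Gamma_pos_of_pos (hα i))
    (Real.Gamma_pos_of_pos (Finset.sum_pos (fun i _ => hα i) Finset.univ_nonempty))

lemma mvBeta_succ {C : ℕ} {α : Fin (C + 2) → ℝ} (hα : ∀ i, 0 < α i) :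
    mvBeta α = mvBeta (fun i : Fin (C + 1) => α i.succ) *
      beta (α 0) (∑ i : Fin (C + 1), α i.succ) := by
  have h := Real.Gamma_pos_of_pos
    (Finset.sum_pos (fun (i : Fin (C + 1)) _ => hα i.succ) Finset.univ_nonempty)
  rw [mvBeta, mvBeta, beta, Fin.prod_univ_succ, Fin.sum_univ_succ]
  field_simp

/-- Dirichlet's integral over the simplex of size `t`. -/
lemma lintegral_dirichletWeight {C : ℕ} (α : Fin (C + 1) → ℝ) (hα : ∀ i, 0 < α i) (t : ℝ) :
    ∫⁻ x, dirichletWeight α t x = ENNReal.ofReal (mvBeta α) * posRpow (∑ i, α i) t := by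
  induction C generalizing t with
  | zero =>
    have h : mvBeta α = 1 := by
      simp [mvBeta, div_self (Real.Gamma_pos_of_pos (hα 0)).ne']
    rw [Measure.volume_pi_eq_dirac (fun i => isEmptyElim i), lintegral_dirac]
    simp [h, dirichletWeight, simplexPoint, Fin.snoc]
  | succ C ih =>
    have hs := Finset.sum_pos (fun (i : Fin (C + 1)) _ => hα i.succ) Finset.univ_nonempty
    have hcons (p : ℝ × (Fin C → ℝ)) :
        dirichletWeight α t ((MeasurableEquiv.piFinSuccAbove (fun _ => ℝ) 0).symm p) =
          posRpow (α 0) p.1 * dirichletWeight (fun i => α i.succ) (t - p.1) p.2 := by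
      have : (MeasurableEquiv.piFinSuccAbove (fun _ : Fin (C + 1) => ℝ) 0).symm p =
          Fin.cons p.1 p.2 := by
        simp [MeasurableEquiv.piFinSuccAbove, Fin.insertNthEquiv]
      rw [this, dirichletWeight, simplexPoint_cons, Fin.prod_univ_succ]
      rfl
    have hm : Measurable fun p : ℝ × (Fin C → ℝ) =>
        posRpow (α 0) p.1 * dirichletWeight (fun i => α i.succ) (t - p.1) p.2 := by
      simp_rw [← hcons]
      fun_prop
    rw [← ((volume_preserving_piFinSuccAbove (fun _ => ℝ) 0).symm).lintegral_comp (by fun_prop)]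
    simp_rw [hcons]
    rw [Measure.volume_eq_prod, lintegral_prod _ hm.aemeasurable]
    have (y : ℝ) : ∫⁻ x : Fin C → ℝ, posRpow (α 0) y *
          dirichletWeight (fun i => α i.succ) (t - y) x =
        ENNReal.ofReal (mvBeta fun i : Fin (C + 1) => α i.succ) *
          (posRpow (α 0) y * posRpow (∑ i : Fin (C + 1), α i.succ) (t - y)) := by
      rw [lintegral_const_mul _ (by fun_prop), ih _ (fun i => hα i.succ)]
      ring
    simp_rw [this]
    rw [lintegral_const_mul _ (by fun_prop), lintegral_posRpow_mul_posRpow (hα 0) hs, ← mul_assoc,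
      ← ENNReal.ofReal_mul (mvBeta_pos fun i => hα i.succ).le, ← mvBeta_succ hα,
      ← Fin.sum_univ_succ]

/-- The Dirichlet measure without its normalising constant, in the first `C` coordinates. -/
noncomputable def dirichletMeasure {C : ℕ} (α : Fin (C + 1) → ℝ) : Measure (Fin C → ℝ) :=
  volume.withDensity (dirichletWeight α 1)

lemma dirichletWeight_ne_zero_iff {C : ℕ} {α : Fin (C + 1) → ℝ} {t : ℝ} {x : Fin C → ℝ} :
    dirichletWeight α t x ≠ 0 ↔ ∀ i, 0 < simplexPoint t x i := by
  simp [dirichletWeight, Finset.prod_eq_zero_iff, posRpow_eq_zero_iff]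

lemma dirichletWeight_of_pos {C : ℕ} {α : Fin (C + 1) → ℝ} {t : ℝ} {x : Fin C → ℝ}
    (hx : ∀ i, 0 < simplexPoint t x i) :
    dirichletWeight α t x = ENNReal.ofReal (∏ i, simplexPoint t x i ^ (α i - 1)) := by
  rw [ENNReal.ofReal_prod_of_nonneg fun i _ => (Real.rpow_pos_of_pos (hx i) _).le]
  exact Finset.prod_congr rfl fun i _ => posRpow_of_pos (hx i)

lemma ae_dirichletMeasure_pos {C : ℕ} (α : Fin (C + 1) → ℝ) :
    ∀ᵐ x ∂dirichletMeasure α, ∀ i, 0 < simplexPoint 1 x i := by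
  rw [dirichletMeasure, ae_withDensity_iff (by fun_prop)]
  exact .of_forall fun x => dirichletWeight_ne_zero_iff.1

lemma ae_sum_ne_one (C : ℕ) : ∀ᵐ x : Fin C → ℝ, ∑ i, x i ≠ 1 := by
  let f : (Fin C → ℝ) →ₗ[ℝ] ℝ := ∑ i, LinearMap.proj i
  have hf (x : Fin C → ℝ) : f x = ∑ i, x i := by simp [f]
  let s : AffineSubspace ℝ (Fin C → ℝ) :=
    (AffineSubspace.mk' (1 : ℝ) ⊥).comap f.toAffineMap
  have hmem (x : Fin C → ℝ) : x ∈ s ↔ ∑ i, x i = 1 := by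
    simp [s, AffineSubspace.mem_comap, AffineSubspace.mem_mk', hf, sub_eq_zero]
  have hs : s ≠ ⊤ := fun h => by
    have := (hmem 0).1 (h ▸ AffineSubspace.mem_top ℝ _ _)
    simp at this
  have h0 := Measure.addHaar_affineSubspace (volume : Measure (Fin C → ℝ)) s hs
  filter_upwards [measure_eq_zero_iff_ae_notMem.1 h0] with x hx h
  exact hx ((hmem x).2 h)

lemma ae_simplexPoint_ne_zero (C : ℕ) : ∀ᵐ x : Fin C → ℝ, ∀ i, simplexPoint 1 x i ≠ 0 := by
  have h : ∀ᵐ x : Fin C → ℝ, ∀ i, x i ≠ 0 := ae_all_iff.2 fun i =>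
    Measure.ae_eval_ne (fun _ => volume) i 0
  filter_upwards [h, ae_sum_ne_one C] with x hx hx' i
  refine Fin.lastCases ?_ (fun j => ?_) i
  · rw [simplexPoint, Fin.snoc_last, sub_ne_zero]
    exact hx'.symm
  · rw [simplexPoint, Fin.snoc_castSucc]
    exact hx j

lemma dirichletExp_eq_integral {C : ℕ} (α : Fin (C + 1) → ℝ) (g : (Fin (C + 1) → ℝ) → ℝ) :
    dirichletExp α g = (∫ x, g (simplexPoint 1 x) ∂dirichletMeasure α) / mvBeta α := by
  have htop (x : Fin C → ℝ) : dirichletWeight α 1 x < ∞ := by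
    refine ENNReal.prod_lt_top fun i _ => ?_
    unfold posRpow
    split_ifs <;> simp
  rw [dirichletMeasure, integral_withDensity_eq_integral_toReal_smul (by fun_prop)
    (.of_forall htop), ← integral_div]
  refine integral_congr_ae ?_
  filter_upwards [ae_simplexPoint_ne_zero C] with x hx
  have hmem : x ∈ {x : Fin C → ℝ | (∀ i, 0 ≤ x i) ∧ ∑ i, x i ≤ 1} ↔
      ∀ i, 0 ≤ simplexPoint 1 x i := by
    simp [Fin.forall_fin_succ', simplexPoint]
  by_cases h : ∀ i, 0 ≤ simplexPoint 1 x i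
  · have hpos i : 0 < simplexPoint 1 x i := (h i).lt_of_ne' (hx i)
    rw [Set.indicator_of_mem (hmem.2 h), dirichletWeight_of_pos hpos,
      ENNReal.toReal_ofReal (Finset.prod_nonneg fun i _ => Real.rpow_nonneg (h i) _),
      dirichletDensity, smul_eq_mul]
    simp only [simplexPoint]
    ring
  · rw [Set.indicator_of_notMem (hmem.not.2 h)]
    have : dirichletWeight α 1 x = 0 := by
      by_contra h0
      exact h fun i => (dirichletWeight_ne_zero_iff.1 h0 i).le
    simp [this]

lemma lintegral_exp_log_simplexPoint {C : ℕ} {α : Fin (C + 1) → ℝ} (hα : ∀ i, 0 < α i)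
    (c : Fin (C + 1)) {s : ℝ} (hs : -α c < s) :
    ∫⁻ x, ENNReal.ofReal (Real.exp (s * Real.log (simplexPoint 1 x c))) ∂dirichletMeasure α =
      ENNReal.ofReal (mvBeta (Function.update α c (α c + s))) := by
  have hα' i : 0 < Function.update α c (α c + s) i := by
    rcases eq_or_ne i c with rfl | h
    · simp; linarith
    · simp [h, hα i]
  rw [dirichletMeasure, lintegral_withDensity_eq_lintegral_mul _ (by fun_prop) (by fun_prop)]
  have key (x : Fin C → ℝ) : (dirichletWeight α 1 *
      fun x => ENNReal.ofReal (Real.exp (s * Real.log (simplexPoint 1 x c)))) x =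
        dirichletWeight (Function.update α c (α c + s)) 1 x := by
    simp only [Pi.mul_apply, dirichletWeight]
    rw [← Finset.mul_prod_erase _ _ (Finset.mem_univ c),
      ← Finset.mul_prod_erase Finset.univ (fun i => posRpow (Function.update α c _ i) _)
        (Finset.mem_univ c), mul_right_comm, posRpow_mul_exp_log, Function.update_self]
    congr 1
    refine Finset.prod_congr rfl fun i hi => ?_
    rw [Function.update_of_ne (Finset.ne_of_mem_erase hi)]
  simp_rw [key]
  rw [lintegral_dirichletWeight _ hα', posRpow_of_pos one_pos]
  simp

lemma integrable_exp_log_simplexPoint {C : ℕ} {α : Fin (C + 1) → ℝ} (hα : ∀ i, 0 < α i)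
    (c : Fin (C + 1)) {s : ℝ} (hs : -α c < s) :
    Integrable (fun x => Real.exp (s * Real.log (simplexPoint 1 x c))) (dirichletMeasure α) := by
  refine ⟨Measurable.aestronglyMeasurable (by fun_prop), ?_⟩
  rw [hasFiniteIntegral_iff_ofReal (.of_forall fun x => (Real.exp_pos _).le),
    lintegral_exp_log_simplexPoint hα c hs]
  exact ENNReal.ofReal_lt_top

lemma zero_mem_interior_integrableExpSet_log_simplexPoint {C : ℕ} {α : Fin (C + 1) → ℝ}
    (hα : ∀ i, 0 < α i) (c : Fin (C + 1)) :
    0 ∈ interior (integrableExpSet (fun x => Real.log (simplexPoint 1 x c))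
      (dirichletMeasure α)) :=
  mem_interior.2 ⟨Set.Ioi (-α c), fun _ hs => integrable_exp_log_simplexPoint hα c hs, isOpen_Ioi,
    neg_lt_zero.2 (hα c)⟩

lemma integrable_log_simplexPoint {C : ℕ} {α : Fin (C + 1) → ℝ} (hα : ∀ i, 0 < α i)
    (c : Fin (C + 1)) :
    Integrable (fun x => Real.log (simplexPoint 1 x c)) (dirichletMeasure α) :=
  integrable_of_mem_interior_integrableExpSet
    (zero_mem_interior_integrableExpSet_log_simplexPoint hα c)

lemma dirichletMeasure_univ {C : ℕ} {α : Fin (C + 1) → ℝ} (hα : ∀ i, 0 < α i) :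
    dirichletMeasure α Set.univ = ENNReal.ofReal (mvBeta α) := by
  rw [dirichletMeasure, withDensity_apply _ .univ, Measure.restrict_univ,
    lintegral_dirichletWeight α hα, posRpow_of_pos one_pos]
  simp

lemma mgf_log_simplexPoint {C : ℕ} {α : Fin (C + 1) → ℝ} (hα : ∀ i, 0 < α i)
    (c : Fin (C + 1)) {s : ℝ} (hs : -α c < s) :
    mgf (fun x => Real.log (simplexPoint 1 x c)) (dirichletMeasure α) s =
      Real.Gamma (α c + s) * (∏ i ∈ Finset.univ.erase c, Real.Gamma (α i)) /
        Real.Gamma (∑ i, α i + s) := by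
  have hupd : mvBeta (Function.update α c (α c + s)) =
      Real.Gamma (α c + s) * (∏ i ∈ Finset.univ.erase c, Real.Gamma (α i)) /
        Real.Gamma (∑ i, α i + s) := by
    have hne i (hi : i ∈ Finset.univ.erase c) : Function.update α c (α c + s) i = α i :=
      Function.update_of_ne (Finset.ne_of_mem_erase hi) _ _
    rw [mvBeta, ← Finset.mul_prod_erase _ _ (Finset.mem_univ c),
      ← Finset.add_sum_erase _ _ (Finset.mem_univ c),
      ← Finset.add_sum_erase Finset.univ α (Finset.mem_univ c), Function.update_self,
      add_right_comm, Finset.sum_congr rfl hne,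
      Finset.prod_congr rfl fun i hi => congrArg Real.Gamma (hne i hi)]
  have hsum : α c ≤ ∑ i, α i :=
    Finset.single_le_sum (fun i _ => (hα i).le) (Finset.mem_univ c)
  have hpos : 0 ≤ mvBeta (Function.update α c (α c + s)) := by
    rw [hupd]
    exact div_nonneg (mul_nonneg (Real.Gamma_pos_of_pos (by linarith)).le
      (Finset.prod_nonneg fun i _ => (Real.Gamma_pos_of_pos (hα i)).le))
      (Real.Gamma_pos_of_pos (by linarith)).le
  rw [mgf, integral_eq_lintegral_of_nonneg_ae (.of_forall fun x => (Real.exp_pos _).le)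
    (Measurable.aestronglyMeasurable (by fun_prop)), lintegral_exp_log_simplexPoint hα c hs, ENNReal.toReal_ofReal hpos, hupd]

lemma hasDerivAt_log_Gamma {a : ℝ} (ha : 0 < a) :
    HasDerivAt (fun y => Real.log (Real.Gamma y)) (digamma a) a :=
  ((Real.differentiableAt_Gamma fun m => by have : (0 : ℝ) ≤ m := m.cast_nonneg; linarith).log
    (Real.Gamma_pos_of_pos ha).ne').hasDerivAt

/-- The expectation of `log p_c` under `Dir(α)` is `ψ(α_c) - ψ(α_0)`. -/
lemma integral_log_simplexPoint {C : ℕ} {α : Fin (C + 1) → ℝ} (hα : ∀ i, 0 < α i)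
    (c : Fin (C + 1)) :
    (∫ x, Real.log (simplexPoint 1 x c) ∂dirichletMeasure α) / mvBeta α =
      digamma (α c) - digamma (∑ i, α i) := by
  have hsum : α c ≤ ∑ i, α i :=
    Finset.single_le_sum (fun i _ => (hα i).le) (Finset.mem_univ c)
  have hP : 0 < ∏ i ∈ Finset.univ.erase c, Real.Gamma (α i) :=
    Finset.prod_pos fun i _ => Real.Gamma_pos_of_pos (hα i)
  have hcgf : cgf (fun x => Real.log (simplexPoint 1 x c)) (dirichletMeasure α) =ᶠ[nhds 0]
      fun s => Real.log (Real.Gamma (α c + s)) +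
        Real.log (∏ i ∈ Finset.univ.erase c, Real.Gamma (α i)) -
          Real.log (Real.Gamma (∑ i, α i + s)) := by
    filter_upwards [Ioi_mem_nhds (neg_lt_zero.2 (hα c))] with s hs
    have hs' : -α c < s := hs
    have h1 := Real.Gamma_pos_of_pos (show 0 < α c + s by linarith)
    have h2 := Real.Gamma_pos_of_pos (show 0 < ∑ i, α i + s by linarith)
    rw [cgf, mgf_log_simplexPoint hα c hs', Real.log_div (by positivity) h2.ne',
      Real.log_mul h1.ne' hP.ne']
  have hshift {a : ℝ} (ha : 0 < a) :
      HasDerivAt (fun s => Real.log (Real.Gamma (a + s))) (digamma a) 0 := by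
    have h : HasDerivAt (fun y => Real.log (Real.Gamma y)) (digamma a) (a + 0) := by
      simpa using hasDerivAt_log_Gamma ha
    exact h.comp_const_add a 0
  have hderiv := (((hshift (hα c)).add_const
    (Real.log (∏ i ∈ Finset.univ.erase c, Real.Gamma (α i)))).sub
      (hshift ((hα c).trans_le hsum))).congr_of_eventuallyEq hcgf
  rw [← hderiv.deriv,
    deriv_cgf_zero (zero_mem_interior_integrableExpSet_log_simplexPoint hα c), measureReal_def,
    dirichletMeasure_univ hα, ENNReal.toReal_ofReal (mvBeta_pos hα).le]

lemma log_dirichletDensity {C : ℕ} {β p : Fin (C + 1) → ℝ} (hβ : ∀ i, 0 < β i)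
    (hp : ∀ i, 0 < p i) :
    Real.log (dirichletDensity β p) =
      ∑ i, (β i - 1) * Real.log (p i) - Real.log (mvBeta β) := by
  have h i : 0 < p i ^ (β i - 1) := Real.rpow_pos_of_pos (hp i) _
  rw [dirichletDensity, Real.log_div (Finset.prod_pos fun i _ => h i).ne' (mvBeta_pos hβ).ne',
    Real.log_prod fun i _ => (h i).ne']
  simp_rw [Real.log_rpow (hp _)]

lemma dirichletDensity_pos {C : ℕ} {β p : Fin (C + 1) → ℝ} (hβ : ∀ i, 0 < β i)
    (hp : ∀ i, 0 < p i) : 0 < dirichletDensity β p :=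
  div_pos (Finset.prod_pos fun i _ => Real.rpow_pos_of_pos (hp i) _) (mvBeta_pos hβ)

lemma isFiniteMeasure_dirichletMeasure {C : ℕ} {α : Fin (C + 1) → ℝ} (hα : ∀ i, 0 < α i) :
    IsFiniteMeasure (dirichletMeasure α) :=
  ⟨by rw [dirichletMeasure_univ hα]; exact ENNReal.ofReal_lt_top⟩

lemma integrable_log_dirichletDensity {C : ℕ} {α β : Fin (C + 1) → ℝ} (hα : ∀ i, 0 < α i)
    (hβ : ∀ i, 0 < β i) :
    Integrable (fun x => Real.log (dirichletDensity β (simplexPoint 1 x)))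
      (dirichletMeasure α) := by
  have := isFiniteMeasure_dirichletMeasure hα
  have h : Integrable (fun x => ∑ i, (β i - 1) * Real.log (simplexPoint 1 x i) -
      Real.log (mvBeta β)) (dirichletMeasure α) :=
    (integrable_finsetSum _ fun i _ => (integrable_log_simplexPoint hα i).const_mul _).sub
      (integrable_const _)
  refine h.congr ?_
  filter_upwards [ae_dirichletMeasure_pos α] with x hx
  rw [log_dirichletDensity hβ hx]

/-- The divergence plus the entropy is the cross-entropy. -/
lemma dirichletKL_add_dirichletEntropy {C : ℕ} {α β : Fin (C + 1) → ℝ} (hα : ∀ i, 0 < α i)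
    (hβ : ∀ i, 0 < β i) :
    dirichletKL α β + dirichletEntropy α =
      Real.log (mvBeta β) - ∑ i, (β i - 1) * (digamma (α i) - digamma (∑ j, α j)) := by
  have := isFiniteMeasure_dirichletMeasure hα
  have hB := mvBeta_pos hα
  have hKL : ∫ x, Real.log (dirichletDensity α (simplexPoint 1 x) /
        dirichletDensity β (simplexPoint 1 x)) ∂dirichletMeasure α =
      ∫ x, Real.log (dirichletDensity α (simplexPoint 1 x)) -
        Real.log (dirichletDensity β (simplexPoint 1 x)) ∂dirichletMeasure α := by
    refine integral_congr_ae ?_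
    filter_upwards [ae_dirichletMeasure_pos α] with x hx
    exact Real.log_div (dirichletDensity_pos hα hx).ne' (dirichletDensity_pos hβ hx).ne'
  have hβint : ∫ x, Real.log (dirichletDensity β (simplexPoint 1 x)) ∂dirichletMeasure α =
      ∑ i, (β i - 1) * ∫ x, Real.log (simplexPoint 1 x i) ∂dirichletMeasure α -
        mvBeta α * Real.log (mvBeta β) := by
    have hi i : Integrable (fun x => (β i - 1) * Real.log (simplexPoint 1 x i))
        (dirichletMeasure α) := (integrable_log_simplexPoint hα i).const_mul _
    have hcongr : (fun x => Real.log (dirichletDensity β (simplexPoint 1 x)))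
        =ᵐ[dirichletMeasure α] fun x => ∑ i, (β i - 1) * Real.log (simplexPoint 1 x i) -
          Real.log (mvBeta β) := by
      filter_upwards [ae_dirichletMeasure_pos α] with x hx
      exact log_dirichletDensity hβ hx
    rw [integral_congr_ae hcongr,
      integral_sub (integrable_finsetSum _ fun i _ => hi i) (integrable_const _),
      integral_finsetSum _ fun i _ => hi i, integral_const, measureReal_def,
      dirichletMeasure_univ hα, ENNReal.toReal_ofReal hB.le, smul_eq_mul]
    simp_rw [integral_const_mul]
  rw [dirichletKL, dirichletEntropy, dirichletExp_eq_integral, dirichletExp_eq_integral, hKL,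
    integral_sub (integrable_log_dirichletDensity hα hα) (integrable_log_dirichletDensity hα hβ),
    integral_neg, hβint]
  simp_rw [← integral_log_simplexPoint hα, mul_div_assoc', ← Finset.sum_div]
  field_simp
  ring

/-- For the one-hot evidence target `α̂` with `α̂_{c*} = 2` and `α̂ᵢ = 1` otherwise, the UCE
loss `ψ(α₀) - ψ(α_{c*})` equals `KL(Dir(α) ‖ Dir(α̂)) + H(Dir(α)) - log B(α̂)`. -/
theorem UCE_eq_KL_add_entropy_sub_logBeta
    (C : ℕ) (α : Fin (C + 1) → ℝ) (hα : ∀ i, 0 < α i)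
    (cstar : Fin (C + 1)) (αhat : Fin (C + 1) → ℝ)
    (hαhat : αhat = fun i => if i = cstar then 2 else 1) :
    digamma (∑ i, α i) - digamma (α cstar) =
      dirichletKL α αhat + dirichletEntropy α - Real.log (mvBeta αhat) := by
  have hhat i : 0 < αhat i := by
    rw [hαhat]
    dsimp only
    split_ifs <;> norm_num
  have hsum : ∑ i, (αhat i - 1) * (digamma (α i) - digamma (∑ j, α j)) =
      digamma (α cstar) - digamma (∑ j, α j) := by
    rw [Finset.sum_eq_single cstar (fun i _ hi => by simp [hαhat, hi]) (by simp), hαhat]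
    norm_num
  rw [dirichletKL_add_dirichletEntropy hα hhat, hsum]
  ring
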